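/- Let 0 < β < 1 and r > 0, and set Λ(x) = x^r. Define P_β(n,t) = ∫_0^∞ e^{-(z t^β)^r} (z t^β)^{rn} / n! · M_β(z) dz. Fix z₀ > 0. Then along any sequence of pairs (n, t) with n a positive integer, t > 0, n t^{-rβ} = z₀^r, and t → ∞, one has t^{rβ} · P_β(n,t) → (z₀^{1−r}/r) · M_β(z₀). -/

import Mathlib

open MeasureTheory Filter Real

/-- The M-Wright (Mainardi) function
`M_β(z) = (1/π) ∑_{j=1}^∞ (−z)^{j−1}/(j−1)! · Γ(βj) · sin(πβj)`. -/
noncomputable def mWright (β z : ℝ) : ℝ :=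
  (1 / π) * ∑' j : ℕ, (-z) ^ j / (Nat.factorial j : ℝ) *
    Real.Gamma (β * (j + 1)) * Real.sin (π * β * (j + 1))

/-- Euler's integral for `Γ(a)` along a rotated ray, `a` real. -/
lemma integral_rpow_mul_cexp_neg_mul_Ioi {a : ℝ} (ha : 0 < a) {b : ℂ} (hb : 0 < b.re) :
    ∫ t in Set.Ioi (0 : ℝ), ((t ^ (a - 1) : ℝ) : ℂ) * Complex.exp (-(b * t)) =
      (Real.Gamma a : ℂ) * b ^ (-(a : ℂ)) := by
  set U : Set ℂ := {w | 0 < w.re} with hU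
  have hUo : IsOpen U := isOpen_lt continuous_const Complex.continuous_re
  have hint : ∀ s : ℝ, -1 < s → ∀ c : ℝ, 0 < c →
      IntegrableOn (fun t : ℝ => t ^ s * rexp (-c * t)) (Set.Ioi 0) := by
    intro s hs c hc
    simpa using integrableOn_rpow_mul_exp_neg_mul_rpow hs one_pos hc
  have hmeas : ∀ s : ℝ, ∀ w : ℂ,
      Measurable (fun t : ℝ => ((t ^ s : ℝ) : ℂ) * Complex.exp (-(w * t))) := by
    intro s w
    fun_prop
  have hnorm : ∀ s : ℝ, ∀ w : ℂ, ∀ t ∈ Set.Ioi (0 : ℝ),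
      ‖((t ^ s : ℝ) : ℂ) * Complex.exp (-(w * t))‖ = t ^ s * rexp (-w.re * t) := by
    intro s w t ht
    rw [norm_mul, Complex.norm_exp, Complex.norm_real, Real.norm_of_nonneg
      (rpow_nonneg (le_of_lt ht) _)]
    simp
  have hF : DifferentiableOn ℂ (fun w : ℂ => ∫ t in Set.Ioi (0 : ℝ),
      ((t ^ (a - 1) : ℝ) : ℂ) * Complex.exp (-(w * t))) U := by
    intro w hw
    have hw' : 0 < w.re := hw
    have hs : {v : ℂ | w.re / 2 < v.re} ∈ nhds w :=
      (isOpen_lt continuous_const Complex.continuous_re).mem_nhds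
        (show w.re / 2 < w.re by linarith)
    have := hasDerivAt_integral_of_dominated_loc_of_deriv_le
      (μ := volume.restrict (Set.Ioi (0 : ℝ)))
      (F := fun (w : ℂ) (t : ℝ) => ((t ^ (a - 1) : ℝ) : ℂ) * Complex.exp (-(w * t)))
      (F' := fun (w : ℂ) (t : ℝ) =>
        ((t ^ (a - 1) : ℝ) : ℂ) * (Complex.exp (-(w * t)) * (-(1 * (t : ℂ)))))
      (bound := fun t => t ^ a * rexp (-(w.re / 2) * t)) hs
      (Eventually.of_forall fun v => (hmeas _ v).aestronglyMeasurable) ?_ ?_ ?_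
      (hint a (by linarith) _ (by linarith)) ?_
    · exact this.2.differentiableAt.differentiableWithinAt
    · refine Integrable.mono' (hint (a - 1) (by linarith) w.re hw')
        (hmeas _ w).aestronglyMeasurable ?_
      filter_upwards [ae_restrict_mem measurableSet_Ioi] with t ht
      exact (hnorm _ w t ht).le
    · exact Measurable.aestronglyMeasurable (by fun_prop)
    · filter_upwards [ae_restrict_mem measurableSet_Ioi] with t ht v hv
      have ht' : 0 < t := ht
      have hv' : w.re / 2 < v.re := hv
      rw [← mul_assoc, norm_mul, hnorm _ v t ht, one_mul, norm_neg, Complex.norm_real,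
        Real.norm_of_nonneg ht'.le]
      calc t ^ (a - 1) * rexp (-v.re * t) * t = t ^ a * rexp (-v.re * t) := by
            rw [rpow_sub_one ht'.ne']; field_simp
        _ ≤ _ := by gcongr
    · refine Eventually.of_forall fun t v _ => ?_
      exact (((hasDerivAt_id v).mul_const (t : ℂ)).neg.cexp).const_mul _
  have hG : DifferentiableOn ℂ (fun w : ℂ => (Real.Gamma a : ℂ) * w ^ (-(a : ℂ))) U := by
    intro w hw
    refine DifferentiableAt.differentiableWithinAt ?_
    exact (differentiableAt_id.cpow_const (Or.inl hw)).const_mul _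
  have hreal : ∀ c : ℝ, 0 < c →
      ∫ t in Set.Ioi (0 : ℝ), ((t ^ (a - 1) : ℝ) : ℂ) * Complex.exp (-((c : ℂ) * t)) =
        (Real.Gamma a : ℂ) * (c : ℂ) ^ (-(a : ℂ)) := by
    intro c hc
    have h := Real.integral_rpow_mul_exp_neg_mul_Ioi ha hc
    have e : ((c : ℂ)) ^ (-(a : ℂ)) = (((1 / c) ^ a : ℝ) : ℂ) := by
      rw [one_div, inv_rpow hc.le, ← rpow_neg hc.le, Complex.ofReal_cpow hc.le]
      simp
    rw [e, mul_comm, ← Complex.ofReal_mul, ← h, ← integral_complex_ofReal]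
    simp
  have hone : (1 : ℂ) ∈ U := by simp [hU]
  have hpre : IsPreconnected U :=
    (convex_halfSpace_re_gt 0).isPreconnected
  refine (hF.analyticOnNhd hUo).eqOn_of_preconnected_of_frequently_eq (hG.analyticOnNhd hUo) hpre
    hone ?_ hb
  have hseq : Tendsto (fun x : ℝ => (x : ℂ)) (nhdsWithin 1 {1}ᶜ) (nhdsWithin (1 : ℂ) {1}ᶜ) := by
    refine tendsto_nhdsWithin_iff.2 ⟨?_, ?_⟩
    · exact (Complex.continuous_ofReal.tendsto' 1 1 (by simp)).mono_left nhdsWithin_le_nhds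
    · filter_upwards [self_mem_nhdsWithin] with x hx
      simpa using hx
  refine hseq.frequently (Eventually.frequently ?_)
  filter_upwards [mem_nhdsWithin_of_mem_nhds (lt_mem_nhds (zero_lt_one' ℝ))] with x hx
  exact hreal x hx

/-- A sublinear power is dominated by an affine function of arbitrarily small slope. -/
lemma exists_mul_rpow_le_add_mul {β : ℝ} (hβ0 : 0 < β) (hβ1 : β < 1) {x c : ℝ} (hx : 0 ≤ x)
    (hc : 0 < c) : ∃ K : ℝ, ∀ t : ℝ, 0 < t → x * t ^ β ≤ K + c * t := by
  have h0 : Tendsto (fun t : ℝ => x * t ^ (-(1 - β))) atTop (nhds 0) := by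
    simpa using (tendsto_rpow_neg_atTop (sub_pos.2 hβ1)).const_mul x
  obtain ⟨R, hR⟩ := eventually_atTop.1 (h0.eventually (gt_mem_nhds hc))
  refine ⟨x * (max R 1) ^ β, fun t ht => ?_⟩
  have hM : (0 : ℝ) ≤ x * (max R 1) ^ β := by positivity
  rcases le_total R t with h | h
  · have h1 : x * t ^ β = x * t ^ (-(1 - β)) * t := by
      rw [neg_sub, rpow_sub_one ht.ne']; field_simp
    have := mul_le_mul_of_nonneg_right (hR t h).le ht.le
    linarith
  · have : x * t ^ β ≤ x * (max R 1) ^ β := by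
      gcongr
      exact h.trans (le_max_left _ _)
    nlinarith

lemma integrableOn_rpow_mul_exp_neg_mul_mul_exp_rpow {β : ℝ} (hβ0 : 0 < β) (hβ1 : β < 1)
    {x c : ℝ} (hx : 0 ≤ x) (hc : 0 < c) :
    IntegrableOn (fun t : ℝ => t ^ (β - 1) * rexp (-c * t) * rexp (x * t ^ β)) (Set.Ioi 0) := by
  obtain ⟨K, hK⟩ := exists_mul_rpow_le_add_mul hβ0 hβ1 hx (half_pos hc)
  have h := (integrableOn_rpow_mul_exp_neg_mul_rpow (p := 1) (s := β - 1) (b := c / 2)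
    (by linarith) one_pos (half_pos hc)).const_mul (rexp K)
  refine Integrable.mono' h (Measurable.aestronglyMeasurable (by fun_prop)) ?_
  filter_upwards [ae_restrict_mem measurableSet_Ioi] with t ht
  have ht' : 0 < t := ht
  have hexp : rexp (-c * t + x * t ^ β) ≤ rexp (K + -(c / 2) * t) :=
    Real.exp_le_exp.2 (by linarith [hK t ht'])
  rw [Real.norm_of_nonneg (by positivity), rpow_one, mul_assoc, ← Real.exp_add, mul_left_comm,
    ← Real.exp_add]
  gcongr

/-- The integrand of the Hankel-type representation of `mWright β z` along a ray at angle `θ`. -/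
noncomputable def mWrightKernel (β θ z t : ℝ) : ℂ :=
  Complex.exp ((θ * β : ℝ) * Complex.I) *
    (((t ^ (β - 1) : ℝ) : ℂ) * Complex.exp (-(Complex.exp ((θ - π : ℝ) * Complex.I) * t))) *
    Complex.exp (-z * ((t ^ β : ℝ) : ℂ) * Complex.exp ((θ * β : ℝ) * Complex.I))

lemma re_exp_sub_pi (θ : ℝ) : (Complex.exp ((θ - π : ℝ) * Complex.I)).re = -Real.cos θ := by
  rw [Complex.exp_ofReal_mul_I_re, Real.cos_sub_pi]

lemma measurable_mWrightKernel (β θ z : ℝ) : Measurable (mWrightKernel β θ z) := by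
  unfold mWrightKernel
  fun_prop

lemma norm_mWrightKernel (β θ z : ℝ) {t : ℝ} (ht : 0 < t) :
    ‖mWrightKernel β θ z t‖ =
      t ^ (β - 1) * rexp (-(-Real.cos θ) * t) * rexp (-(z * t ^ β * Real.cos (θ * β))) := by
  have h1 : (Complex.exp ((θ - π : ℝ) * Complex.I) * (t : ℂ)).re = -Real.cos θ * t := by
    rw [Complex.re_mul_ofReal, re_exp_sub_pi]
  have h2 : (-z * ((t ^ β : ℝ) : ℂ) * Complex.exp ((θ * β : ℝ) * Complex.I)).re =
      -(z * t ^ β * Real.cos (θ * β)) := by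
    rw [← Complex.ofReal_neg, ← Complex.ofReal_mul, Complex.re_ofReal_mul,
      Complex.exp_ofReal_mul_I_re]
    ring
  rw [mWrightKernel, norm_mul, norm_mul, norm_mul, Complex.norm_exp_ofReal_mul_I, one_mul,
    Complex.norm_real, Real.norm_of_nonneg (rpow_nonneg ht.le _), Complex.norm_exp,
    Complex.norm_exp, h2, Complex.neg_re, h1, neg_mul (-Real.cos θ)]

lemma mWright_eq_integral {β : ℝ} (hβ0 : 0 < β) (hβ1 : β < 1) {θ : ℝ} (hθ : π / 2 < θ)
    (hθπ : θ ≤ π) (z : ℝ) :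
    mWright β z = (1 / π) * (∫ t in Set.Ioi (0 : ℝ), mWrightKernel β θ z t).im := by
  set b : ℂ := Complex.exp ((θ - π : ℝ) * Complex.I) with hb
  set c : ℝ := -Real.cos θ with hc
  have hc0 : 0 < c := by
    have := Real.cos_neg_of_pi_div_two_lt_of_lt hθ (by linarith [pi_pos])
    linarith
  have hbre : b.re = c := re_exp_sub_pi θ
  let F : ℕ → ℝ → ℂ := fun j t => (((-z) ^ j / (Nat.factorial j : ℝ) : ℝ) : ℂ) *
    Complex.exp ((θ * β * (j + 1) : ℝ) * Complex.I) *
      (((t ^ (β * (j + 1) - 1) : ℝ) : ℂ) * Complex.exp (-(b * t)))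
  let bound : ℕ → ℝ → ℝ := fun j t =>
    t ^ (β - 1) * rexp (-c * t) * ((|z| * t ^ β) ^ j / (Nat.factorial j : ℝ))
  have hpow : ∀ (j : ℕ) (t : ℝ), 0 < t →
      t ^ (β * (j + 1) - 1) = t ^ (β - 1) * (t ^ β) ^ j := by
    intro j t ht
    rw [← rpow_natCast (t ^ β), ← rpow_mul ht.le, ← rpow_add ht]
    ring_nf
  have hbs : ∀ t : ℝ, HasSum (fun j => bound j t)
      (t ^ (β - 1) * rexp (-c * t) * rexp (|z| * t ^ β)) := by
    intro t
    have h := NormedSpace.expSeries_div_hasSum_exp (|z| * t ^ β)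
    rw [← Real.exp_eq_exp_ℝ] at h
    exact h.mul_left _
  have hsum : HasSum (fun j => ∫ t in Set.Ioi (0 : ℝ), F j t)
      (∫ t in Set.Ioi (0 : ℝ), mWrightKernel β θ z t) := by
    have hFm : ∀ j, Measurable (F j) := fun j => by
      simp only [F]
      fun_prop
    refine hasSum_integral_of_dominated_convergence bound
      (fun j => (hFm j).aestronglyMeasurable) ?_
      (Eventually.of_forall fun t => (hbs t).summable) ?_ ?_
    · intro j
      filter_upwards [ae_restrict_mem measurableSet_Ioi] with t ht
      have ht' : 0 < t := ht
      refine le_of_eq ?_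
      simp only [F, bound]
      rw [norm_mul, norm_mul, norm_mul, Complex.norm_exp_ofReal_mul_I, Complex.norm_real,
        Complex.norm_real, Complex.norm_exp, Complex.neg_re, Complex.re_mul_ofReal, hbre,
        Real.norm_of_nonneg (rpow_nonneg ht'.le _), hpow j t ht', norm_div, norm_pow, norm_neg,
        Real.norm_eq_abs, Real.norm_natCast, mul_pow, ← neg_mul c t]
      ring
    · simp_rw [fun t => (hbs t).tsum_eq]
      exact integrableOn_rpow_mul_exp_neg_mul_mul_exp_rpow hβ0 hβ1 (abs_nonneg z) hc0
    · filter_upwards [ae_restrict_mem measurableSet_Ioi] with t ht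
      have h := NormedSpace.expSeries_div_hasSum_exp
        (-z * ((t ^ β : ℝ) : ℂ) * Complex.exp ((θ * β : ℝ) * Complex.I))
      rw [← Complex.exp_eq_exp_ℂ] at h
      replace h := h.mul_left (Complex.exp ((θ * β : ℝ) * Complex.I) *
        (((t ^ (β - 1) : ℝ) : ℂ) * Complex.exp (-(b * t))))
      convert! h using 1
      funext j
      have he : Complex.exp ((θ * β * (j + 1) : ℝ) * Complex.I) =
          Complex.exp ((θ * β : ℝ) * Complex.I) * Complex.exp ((θ * β : ℝ) * Complex.I) ^ j := by
        rw [← Complex.exp_nat_mul, ← Complex.exp_add]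
        push_cast
        ring_nf
      simp only [F]
      rw [he, hpow j t ht, mul_pow, mul_pow]
      push_cast
      ring
  have hterm : ∀ j : ℕ, (∫ t in Set.Ioi (0 : ℝ), F j t).im =
      (-z) ^ j / (Nat.factorial j : ℝ) * Real.Gamma (β * (j + 1)) *
        Real.sin (π * β * (j + 1)) := by
    intro j
    have ha : 0 < β * (j + 1) := by positivity
    have hlog : b ^ (-((β * (j + 1) : ℝ) : ℂ)) =
        Complex.exp (((π - θ) * (β * (j + 1)) : ℝ) * Complex.I) := by
      rw [Complex.cpow_def_of_ne_zero (Complex.exp_ne_zero _), Complex.log_exp]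
      · push_cast; ring_nf
      · simp; linarith [pi_pos]
      · simp; linarith [pi_pos]
    simp only [F]
    rw [integral_const_mul, integral_rpow_mul_cexp_neg_mul_Ioi ha (hbre ▸ hc0), hlog,
      mul_assoc, mul_left_comm (Complex.exp _), ← Complex.exp_add, ← add_mul,
      ← Complex.ofReal_add, Complex.im_ofReal_mul, Complex.im_ofReal_mul,
      Complex.exp_ofReal_mul_I_im]
    ring_nf
  rw [mWright, ← (Complex.hasSum_im hsum).tsum_eq]
  simp_rw [hterm]

/-- Boundedness of `mWright β` on the half-line, together with its continuity there. -/
lemma mWright_continuousOn_and_bounded {β : ℝ} (hβ0 : 0 < β) (hβ1 : β < 1) :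
    ContinuousOn (mWright β) (Set.Ici 0) ∧ ∃ C : ℝ, ∀ z, 0 ≤ z → |mWright β z| ≤ C := by
  obtain ⟨θ, hθ, hθπ, hθβ⟩ : ∃ θ : ℝ, π / 2 < θ ∧ θ ≤ π ∧ θ * β ≤ π / 2 := by
    refine ⟨min π (π / 2 / β), lt_min (by linarith [pi_pos]) ?_, min_le_left _ _, ?_⟩
    · rw [lt_div_iff₀ hβ0]
      nlinarith [pi_pos]
    · calc min π (π / 2 / β) * β ≤ π / 2 / β * β := by gcongr; exact min_le_right _ _
        _ = π / 2 := by field_simp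
  have hcos : 0 ≤ Real.cos (θ * β) :=
    Real.cos_nonneg_of_mem_Icc ⟨by nlinarith [pi_pos], hθβ⟩
  have hc0 : 0 < -Real.cos θ := by
    have := Real.cos_neg_of_pi_div_two_lt_of_lt hθ (by linarith [pi_pos])
    linarith
  have hint : IntegrableOn (fun t : ℝ => t ^ (β - 1) * rexp (-(-Real.cos θ) * t)) (Set.Ioi 0) := by
    simpa using integrableOn_rpow_mul_exp_neg_mul_mul_exp_rpow hβ0 hβ1 le_rfl hc0
  have hle : ∀ z ∈ Set.Ici (0 : ℝ), ∀ᵐ t ∂(volume.restrict (Set.Ioi (0 : ℝ))),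
      ‖mWrightKernel β θ z t‖ ≤ t ^ (β - 1) * rexp (-(-Real.cos θ) * t) := by
    intro z hz
    filter_upwards [ae_restrict_mem measurableSet_Ioi] with t ht
    have ht' : 0 < t := ht
    have hz' : 0 ≤ z := hz
    rw [norm_mWrightKernel β θ z ht']
    refine mul_le_of_le_one_right (by positivity) ?_
    rw [Real.exp_le_one_iff]
    have : 0 ≤ z * t ^ β * Real.cos (θ * β) := by positivity
    linarith
  have hrep : mWright β =
      fun z => (1 / π) * (∫ t in Set.Ioi (0 : ℝ), mWrightKernel β θ z t).im :=
    funext fun z => mWright_eq_integral hβ0 hβ1 hθ hθπ z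
  constructor
  · rw [hrep]
    refine continuousOn_const.mul (Complex.continuous_im.comp_continuousOn
      (continuousOn_of_dominated (fun z _ => (measurable_mWrightKernel β θ z).aestronglyMeasurable)
        hle hint (Eventually.of_forall fun t => Continuous.continuousOn ?_)))
    unfold mWrightKernel
    fun_prop
  · refine ⟨(1 / π) * ∫ t in Set.Ioi (0 : ℝ), t ^ (β - 1) * rexp (-(-Real.cos θ) * t),
      fun z hz => ?_⟩
    rw [hrep, abs_mul, abs_of_pos (one_div_pos.2 pi_pos)]
    gcongr
    exact (Complex.abs_im_le_norm _).trans (norm_integral_le_of_norm_le hint (hle z hz))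

/-- `Γ(n + s) / n!` is asymptotic to `n ^ (s - 1)`. -/
lemma tendsto_rpow_mul_Gamma_add_div_factorial {s : ℝ} (hs : 0 < s) :
    Tendsto (fun n : ℕ => (n : ℝ) ^ (1 - s) * Real.Gamma (n + s) / (Nat.factorial n : ℝ))
      atTop (nhds 1) := by
  have hG := Real.Gamma_pos_of_pos hs
  have hprod : ∀ n : ℕ, (∏ j ∈ Finset.range n, (s + j)) * Real.Gamma s = Real.Gamma (n + s) := by
    intro n
    induction n with
    | zero => simp
    | succ n ih =>
      rw [Finset.prod_range_succ, mul_right_comm, ih, mul_comm, add_comm s,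
        ← Real.Gamma_add_one (by positivity)]
      push_cast
      ring_nf
  have h1 : Tendsto (fun n : ℕ => Real.Gamma s / Real.GammaSeq s n * ((n : ℝ) / (n + s)))
      atTop (nhds (Real.Gamma s / Real.Gamma s * 1)) :=
    (tendsto_const_nhds.div (Real.GammaSeq_tendsto_Gamma s) hG.ne').mul
      (tendsto_natCast_div_add_atTop s)
  rw [div_self hG.ne', one_mul] at h1
  refine h1.congr' ?_
  filter_upwards [eventually_gt_atTop 0] with n hn
  have hn' : (0 : ℝ) < n := by exact_mod_cast hn
  have hp : 0 < ∏ j ∈ Finset.range n, (s + (j : ℝ)) := Finset.prod_pos fun j _ => by positivity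
  rw [Real.GammaSeq, Finset.prod_range_succ, ← hprod n, rpow_sub hn', rpow_one]
  field_simp
  ring

/-- The weight `A · e^{-A z^r} (A z^r)^n / n!`. -/
noncomputable def poissonWeight (r A : ℝ) (n : ℕ) (z : ℝ) : ℝ :=
  A * (rexp (-(A * z ^ r)) * (A * z ^ r) ^ n / (Nat.factorial n : ℝ))

lemma poissonWeight_nonneg {r A z : ℝ} (hA : 0 ≤ A) (hz : 0 ≤ z) (n : ℕ) :
    0 ≤ poissonWeight r A n z := by
  unfold poissonWeight
  positivity

lemma poissonWeight_mul_pow {r A z : ℝ} (hz : 0 < z) (n m : ℕ) :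
    poissonWeight r A n z * (z ^ r) ^ m =
      A ^ (n + 1) / (Nat.factorial n : ℝ) * (z ^ (r * (n + m)) * rexp (-A * z ^ r)) := by
  have h : z ^ (r * (n + m)) = (z ^ r) ^ n * (z ^ r) ^ m := by
    rw [← pow_add, ← rpow_natCast (z ^ r), ← rpow_mul hz.le]
    push_cast
    rfl
  rw [h, poissonWeight, mul_pow, neg_mul]
  ring

lemma integrableOn_poissonWeight_mul_pow {r A : ℝ} (hr : 0 < r) (hA : 0 < A) (n m : ℕ) :
    IntegrableOn (fun z => poissonWeight r A n z * (z ^ r) ^ m) (Set.Ioi 0) := by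
  have hq : (-1 : ℝ) < r * (n + m) := neg_one_lt_zero.trans_le (by positivity)
  exact IntegrableOn.congr_fun ((integrableOn_rpow_mul_exp_neg_mul_rpow hq hr hA).const_mul _)
    (fun z hz => (poissonWeight_mul_pow hz n m).symm) measurableSet_Ioi

lemma integral_poissonWeight_mul_pow {r A : ℝ} (hr : 0 < r) (hA : 0 < A) (n m : ℕ) :
    ∫ z in Set.Ioi (0 : ℝ), poissonWeight r A n z * (z ^ r) ^ m =
      A ^ (1 - (m + 1 / r)) * (1 / r) * Real.Gamma (n + (m + 1 / r)) / (Nat.factorial n : ℝ) := by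
  have hq : (-1 : ℝ) < r * (n + m) := neg_one_lt_zero.trans_le (by positivity)
  rw [setIntegral_congr_fun measurableSet_Ioi fun z hz => poissonWeight_mul_pow hz n m,
    integral_const_mul, integral_rpow_mul_exp_neg_mul_rpow hr hq hA]
  have h1 : (r * (n + m) + 1) / r = n + (m + 1 / r) := by
    field_simp
    ring
  have h2 : A ^ (1 - (m + 1 / r)) = A ^ (n + 1) * A ^ (-(r * (n + m) + 1) / r) := by
    rw [← rpow_natCast A (n + 1), ← rpow_add hA, neg_div, h1]
    push_cast
    ring_nf
  rw [h1, h2]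
  ring

lemma tendsto_integral_poissonWeight_mul_pow {r c : ℝ} (hr : 0 < r) (hc : 0 < c) (m : ℕ) :
    Tendsto (fun n : ℕ => ∫ z in Set.Ioi (0 : ℝ), poissonWeight r (n / c) n z * (z ^ r) ^ m)
      atTop (nhds (c ^ m * (c ^ (1 / r - 1) / r))) := by
  have h := (tendsto_rpow_mul_Gamma_add_div_factorial (s := m + 1 / r) (by positivity)).const_mul
    (c ^ m * (c ^ (1 / r - 1) / r))
  rw [mul_one] at h
  refine h.congr' ?_
  filter_upwards [eventually_gt_atTop 0] with n hn
  have hn' : (0 : ℝ) < n := by exact_mod_cast hn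
  have hcp : c ^ (1 - (m + 1 / r)) = (c ^ m * c ^ (1 / r - 1))⁻¹ := by
    rw [← rpow_natCast c m, ← rpow_add hc, ← rpow_neg hc.le]
    ring_nf
  rw [integral_poissonWeight_mul_pow hr (by positivity), div_rpow hn'.le hc.le, hcp]
  field_simp

/-- The weights concentrate at `z₀`. -/
lemma tendsto_integral_poissonWeight_mul {r z₀ : ℝ} (hr : 0 < r) (hz₀ : 0 < z₀) {f : ℝ → ℝ}
    (hf : ContinuousOn f (Set.Ici 0)) {C : ℝ} (hC : ∀ z, 0 ≤ z → |f z| ≤ C) :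
    Tendsto (fun n : ℕ => ∫ z in Set.Ioi (0 : ℝ), poissonWeight r (n / z₀ ^ r) n z * f z)
      atTop (nhds (z₀ ^ (1 - r) / r * f z₀)) := by
  set c : ℝ := z₀ ^ r with hcdef
  have hc : 0 < c := rpow_pos_of_pos hz₀ r
  set L : ℝ := z₀ ^ (1 - r) / r with hL
  have hL0 : 0 < L := by positivity
  have hcL : c ^ (1 / r - 1) / r = L := by
    rw [hL, hcdef, ← rpow_mul hz₀.le]
    congr 2
    field_simp
  have hJ : ∀ m : ℕ, Tendsto
      (fun n : ℕ => ∫ z in Set.Ioi (0 : ℝ), poissonWeight r (n / c) n z * (z ^ r) ^ m)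
      atTop (nhds (c ^ m * L)) := fun m => hcL ▸ tendsto_integral_poissonWeight_mul_pow hr hc m
  set J : ℕ → ℕ → ℝ := fun m n =>
    ∫ z in Set.Ioi (0 : ℝ), poissonWeight r (n / c) n z * (z ^ r) ^ m with hJdef
  have hC0 : 0 ≤ C := (abs_nonneg _).trans (hC 0 le_rfl)
  have hmod : ∀ ε : ℝ, 0 < ε → ∃ K : ℝ, ∀ z, 0 < z →
      |f z - f z₀| ≤ ε + K * (z ^ r - c) ^ 2 := by
    intro ε hε
    have hroot : ∀ z : ℝ, 0 ≤ z → (z ^ r) ^ (1 / r) = z := fun z hz => by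
      rw [← rpow_mul hz, mul_one_div_cancel hr.ne', rpow_one]
    have hcont : ContinuousAt (fun y : ℝ => f (y ^ (1 / r))) c := by
      refine ContinuousAt.comp (f := fun y : ℝ => y ^ (1 / r)) (g := f) ?_
        (continuousAt_rpow_const _ _ (Or.inl hc.ne'))
      rw [hroot z₀ hz₀.le]
      exact hf.continuousAt (Ici_mem_nhds hz₀)
    obtain ⟨η, hη, h⟩ := Metric.continuousAt_iff.1 hcont ε hε
    refine ⟨2 * C / η ^ 2, fun z hz => ?_⟩
    by_cases hd : |z ^ r - c| < η
    · have h' := h (x := z ^ r) hd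
      rw [hroot z hz.le, hroot z₀ hz₀.le, Real.dist_eq] at h'
      have : 0 ≤ 2 * C / η ^ 2 * (z ^ r - c) ^ 2 := by positivity
      linarith
    · have h1 : η ^ 2 ≤ (z ^ r - c) ^ 2 := by
        rw [← sq_abs (z ^ r - c)]
        gcongr
        exact not_lt.1 hd
      have h2 : 2 * C ≤ 2 * C / η ^ 2 * (z ^ r - c) ^ 2 := by
        rw [div_mul_eq_mul_div, le_div_iff₀ (by positivity)]
        gcongr
      have h3 := (abs_sub (f z) (f z₀)).trans (add_le_add (hC z hz.le) (hC z₀ hz₀.le))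
      linarith
  have hdiff : Tendsto (fun n : ℕ =>
      (∫ z in Set.Ioi (0 : ℝ), poissonWeight r (n / c) n z * f z) - J 0 n * f z₀)
      atTop (nhds 0) := by
    rw [Metric.tendsto_nhds]
    intro ε hε
    obtain ⟨K, hK⟩ := hmod (ε / (2 * L)) (by positivity)
    have hlim : Tendsto (fun n : ℕ => (ε / (2 * L) + K * c ^ 2) * J 0 n - 2 * c * K * J 1 n
        + K * J 2 n) atTop (nhds (ε / 2)) := by
      convert! (((hJ 0).const_mul (ε / (2 * L) + K * c ^ 2)).sub
        ((hJ 1).const_mul (2 * c * K))).add ((hJ 2).const_mul K) using 2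
      field_simp
      ring
    filter_upwards [hlim.eventually (gt_mem_nhds (half_lt_self hε)), eventually_gt_atTop 0]
      with n hn hn0
    have hA : (0 : ℝ) < n / c := by
      have : (0 : ℝ) < n := by exact_mod_cast hn0
      positivity
    have hi := fun m => integrableOn_poissonWeight_mul_pow hr hA n m
    have hi0 : IntegrableOn (poissonWeight r (n / c) n) (Set.Ioi 0) := by simpa using hi 0
    have hif : IntegrableOn (fun z => poissonWeight r (n / c) n z * f z) (Set.Ioi 0) := by
      refine Integrable.mul_bdd (c := C) hi0
        ((hf.mono Set.Ioi_subset_Ici_self).aestronglyMeasurable measurableSet_Ioi) ?_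
      filter_upwards [ae_restrict_mem measurableSet_Ioi] with z hz
      exact hC z (le_of_lt hz)
    have hJ0 : J 0 n * f z₀ = ∫ z in Set.Ioi (0 : ℝ), poissonWeight r (n / c) n z * f z₀ := by
      rw [integral_mul_const]
      simp [hJdef]
    rw [Real.dist_eq, sub_zero, hJ0, ← integral_sub hif (hi0.mul_const _)]
    refine lt_of_le_of_lt ?_ hn
    have hik : ∀ (m : ℕ) (k : ℝ), IntegrableOn
        (fun z => k * (poissonWeight r (n / c) n z * (z ^ r) ^ m)) (Set.Ioi 0) :=
      fun m k => (hi m).const_mul k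
    have hi01 : IntegrableOn (fun z =>
        (ε / (2 * L) + K * c ^ 2) * (poissonWeight r (n / c) n z * (z ^ r) ^ 0) -
          2 * c * K * (poissonWeight r (n / c) n z * (z ^ r) ^ 1)) (Set.Ioi 0) :=
      (hik 0 _).sub (hik 1 _)
    have hsplit : (ε / (2 * L) + K * c ^ 2) * J 0 n - 2 * c * K * J 1 n + K * J 2 n =
        ∫ z in Set.Ioi (0 : ℝ),
          ((ε / (2 * L) + K * c ^ 2) * (poissonWeight r (n / c) n z * (z ^ r) ^ 0) -
            2 * c * K * (poissonWeight r (n / c) n z * (z ^ r) ^ 1) +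
            K * (poissonWeight r (n / c) n z * (z ^ r) ^ 2)) := by
      rw [integral_add hi01 (hik 2 K), integral_sub (hik 0 _) (hik 1 _), integral_const_mul,
        integral_const_mul, integral_const_mul]
    rw [hsplit]
    rw [← Real.norm_eq_abs]
    refine norm_integral_le_of_norm_le (hi01.add (hik 2 K)) ?_
    filter_upwards [ae_restrict_mem measurableSet_Ioi] with z hz
    have hw := poissonWeight_nonneg (r := r) hA.le (le_of_lt hz) n
    rw [← mul_sub, norm_mul, Real.norm_of_nonneg hw, Real.norm_eq_abs]
    calc _ ≤ poissonWeight r (n / c) n z * (ε / (2 * L) + K * (z ^ r - c) ^ 2) := by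
          gcongr
          exact hK z hz
      _ = _ := by simp; ring
  have h := hdiff.add (Tendsto.mul_const (f z₀) (show Tendsto (J 0) atTop _ from hJ 0))
  simpa only [sub_add_cancel, zero_add, pow_zero, one_mul] using h

/-- Dynamical scaling for the fractional non-homogeneous Poisson process with
cumulative intensity `Λ(x) = x^r`. -/
theorem fnhPp_power_intensity_dynamical_scaling
    (β : ℝ) (hβ0 : 0 < β) (hβ1 : β < 1)
    (r : ℝ) (hr : 0 < r)
    (P : ℕ → ℝ → ℝ)
    (hP : ∀ (n : ℕ) (t : ℝ), 0 < t →
      P n t = ∫ z in Set.Ioi (0 : ℝ),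
        Real.exp (-(z * t ^ β) ^ r) * (z * t ^ β) ^ (r * n) / (Nat.factorial n : ℝ) *
          mWright β z)
    (z₀ : ℝ) (hz₀ : 0 < z₀)
    (n : ℕ → ℕ) (t : ℕ → ℝ)
    (hn : ∀ k, 0 < n k) (ht : ∀ k, 0 < t k)
    (hrel : ∀ k, (n k : ℝ) * (t k) ^ (-(r * β)) = z₀ ^ r)
    (htinf : Tendsto t atTop atTop) :
    Tendsto (fun k => (t k) ^ (r * β) * P (n k) (t k)) atTop
      (nhds (z₀ ^ (1 - r) / r * mWright β z₀)) := by
  obtain ⟨hcont, C, hC⟩ := mWright_continuousOn_and_bounded hβ0 hβ1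
  have hc : 0 < z₀ ^ r := rpow_pos_of_pos hz₀ r
  have hT : ∀ k, (n k : ℝ) = z₀ ^ r * t k ^ (r * β) := fun k => by
    rw [← hrel k, mul_assoc, ← rpow_add (ht k), neg_add_cancel, rpow_zero, mul_one]
  have hninf : Tendsto n atTop atTop := by
    rw [← tendsto_natCast_atTop_iff (R := ℝ)]
    simp_rw [hT]
    exact ((tendsto_rpow_atTop (mul_pos hr hβ0)).comp htinf).const_mul_atTop hc
  refine ((tendsto_integral_poissonWeight_mul hr hz₀ hcont hC).comp hninf).congr fun k => ?_
  have hA : (n k : ℝ) / z₀ ^ r = t k ^ (r * β) := by rw [hT k]; field_simp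
  rw [hP _ _ (ht k), ← integral_const_mul, Function.comp_apply, hA]
  refine setIntegral_congr_fun measurableSet_Ioi fun z hz => ?_
  have hz' : 0 < z := hz
  have htk := ht k
  have hpow : (z * t k ^ β) ^ r = t k ^ (r * β) * z ^ r := by
    rw [mul_rpow hz'.le (by positivity), ← rpow_mul htk.le, mul_comm β r, mul_comm]
  simp only [poissonWeight]
  rw [rpow_mul (show 0 ≤ z * t k ^ β by positivity), hpow, rpow_natCast]
  ring
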